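/- Let q ≡ 1 (mod 3) be a prime power and T a generator of the character group of F_q^*. Then for every integer k, G_k · G_{k+(q-1)/3} · G_{k+2(q-1)/3} = q · T^{-k}(27) · G_{3k}, where G_m denotes the Gauss sum of T^m with respect to the canonical additive character. -/

import Mathlib

open Finset

/-- The canonical additive character `θ(α) = e^{2πi·tr(α)/p}` of `F = F_q`, `q = p^e`. -/
noncomputable def theta (p : ℕ) (F : Type) [Field F] [Fintype F] [Algebra (ZMod p) F]
    (α : F) : ℂ :=
  Complex.exp (2 * Real.pi * Complex.I * ((Algebra.trace (ZMod p) F α).val : ℂ) / p)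

/-- The Gauss sum `G_m = ∑_{x ∈ F_q} T^m(x) θ(x)` (recall `T^m (0) = 0` for `T^m` nontrivial,
and characters are extended by `χ(0) = 0`). -/
noncomputable def gaussT (p : ℕ) (F : Type) [Field F] [Fintype F] [Algebra (ZMod p) F]
    (T : MulChar F ℂ) (m : ℤ) : ℂ :=
  ∑ x : F, (T ^ m) x * theta p F x

/-- The normalized Jacobi sum `binom(A,B) = (B(-1)/q) · J(A, B̄)`. -/
noncomputable def binomC (F : Type) [Field F] [Fintype F] (A B : MulChar F ℂ) : ℂ :=
  B (-1) / (Fintype.card F : ℂ) * jacobiSum A B⁻¹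

/-- Greene's Gaussian hypergeometric series `₂F₁(A,B;C|x)_q`, the sum over all
multiplicative characters `χ = T^m` of `F_q^*`, written via a generator `T` of the
character group. -/
noncomputable def hypF21 (F : Type) [Field F] [Fintype F] (T : MulChar F ℂ)
    (A B C : MulChar F ℂ) (x : F) : ℂ :=
  (Fintype.card F : ℂ) / ((Fintype.card F : ℂ) - 1) *
    ∑ m ∈ Finset.range (Fintype.card F - 1),
      binomC F (A * T ^ m) (T ^ m) * binomC F (B * T ^ m) (C * T ^ m) * (T ^ m) x

section CubicFiber

variable {F : Type*} [Field F]

lemma MulChar.apply_pow_three_eq_one {ω : MulChar F ℂ} (hω : ω ^ 3 = 1) {x : F} (hx : x ≠ 0) :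
    ω (x ^ 3) = 1 := by
  rw [map_pow, ← MulChar.pow_apply' _ three_ne_zero, hω, MulChar.one_apply hx.isUnit]

lemma MulChar.apply_neg_one_of_pow_three_eq_one {ω : MulChar F ℂ} (hω : ω ^ 3 = 1) :
    ω (-1) = 1 := by
  have h := apply_pow_three_eq_one hω (neg_ne_zero.2 one_ne_zero)
  rwa [Odd.neg_one_pow (by decide)] at h

/-- The quadratic `u² - u + c` is, up to scaling, the Lagrange resolvent of `y³ - 3cy + c`: a root `y` of
the cubic makes `-cu` a cube. -/
lemma MulChar.apply_resolvent_eq_one {ω : MulChar F ℂ} (hω : ω ^ 3 = 1) {c u y : F} (hc : c ≠ 0)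
    (hy : y ^ 3 = c * (3 * y - 1)) (hu : u * (1 - u) = c) (hyc : y ^ 2 ≠ c) :
    ω (-c * u) = 1 := by
  have hyc' : y ^ 2 - c ≠ 0 := sub_ne_zero.2 hyc
  have hcube : -c * u = (c * (y - u) / (y ^ 2 - c)) ^ 3 := by
    rw [div_pow, eq_div_iff (pow_ne_zero _ hyc')]
    grind
  have hu0 : u ≠ 0 := by
    rintro rfl
    exact hc (by simpa using hu.symm)
  have hne : c * (y - u) / (y ^ 2 - c) ≠ 0 := fun h ↦ by
    rw [h] at hcube
    exact mul_ne_zero (neg_ne_zero.2 hc) hu0 (by simpa using hcube)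
  rw [hcube, apply_pow_three_eq_one hω hne]

lemma MulChar.apply_mul_inv_apply_one_sub_eq_one {ω : MulChar F ℂ} (hω : ω ^ 3 = 1) {c u y : F}
    (hc : c ≠ 0) (hy : y ^ 3 = c * (3 * y - 1)) (hu : u * (1 - u) = c) :
    ω u * ω⁻¹ (1 - u) = 1 := by
  have hu0 : u ≠ 0 := by
    rintro rfl
    exact hc (by simpa using hu.symm)
  have hunit : ω u ≠ 0 := (hu0.isUnit.map ω).ne_zero
  have key : ω (1 - u) = ω u := by
    by_cases hyc : y ^ 2 = c
    · have : u = y := by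
        have : (u - y) ^ 2 = 0 := by grind
        simpa [sub_eq_zero] using this
      congr 1
      grind
    · have h₁ := apply_resolvent_eq_one hω hc hy hu hyc
      have h₂ := apply_resolvent_eq_one (u := 1 - u) hω hc hy (by linear_combination hu) hyc
      have hc' : ω (-c) ≠ 0 := ((neg_ne_zero.2 hc).isUnit.map ω).ne_zero
      rw [map_mul] at h₁ h₂
      exact mul_left_cancel₀ hc' (h₂.trans h₁.symm)
  rw [MulChar.inv_apply_eq_inv', key, mul_inv_cancel₀ hunit]

/-- If `y³ - 3cy + c` has two distinct roots, its resolvent quadratic splits. -/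
lemma exists_mul_one_sub_eq {ζ c y z : F} (hζ : ζ ^ 2 + ζ + 1 = 0) (h3 : (3 : F) ≠ 0) (hc : c ≠ 0)
    (hy : y ^ 3 = c * (3 * y - 1)) (hz : z ^ 3 = c * (3 * z - 1)) (hyz : y ≠ z) :
    ∃ u, u * (1 - u) = c := by
  have hsum : y ^ 2 + y * z + z ^ 2 = 3 * c :=
    mul_left_cancel₀ (sub_ne_zero.2 hyz) (by linear_combination hy - hz)
  set a := (y + ζ * z - ζ ^ 2 * (y + z)) / 3 with ha
  set b := (y + ζ ^ 2 * z - ζ * (y + z)) / 3 with hb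
  have hab : a * b = c := by grind
  have h : a ^ 3 + b ^ 3 = -c := by
    have : y = a + b := by grind
    grind
  clear_value a b
  refine ⟨-a ^ 3 / c, ?_⟩
  field_simp
  linear_combination -a ^ 3 * h + (a ^ 2 * b ^ 2 + a * b * c + c ^ 2) * hab

variable [Fintype F] [DecidableEq F]

lemma card_cubic_roots_le_three (c : F) :
    #{y : F | y ^ 3 = c * (3 * y - 1)} ≤ 3 := by
  by_cases h : ∃ y z : F, y ^ 3 = c * (3 * y - 1) ∧ z ^ 3 = c * (3 * z - 1) ∧ y ≠ z
  · obtain ⟨y, z, hy, hz, hyz⟩ := h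
    refine (card_le_card (t := {y, z, -(y + z)}) fun x hx ↦ ?_).trans card_le_three
    simp only [mem_filter, mem_univ, true_and, mem_insert, mem_singleton] at hx ⊢
    by_contra! hne
    obtain ⟨hxy, hxz, hxyz⟩ := hne
    have h₁ : x ^ 2 + x * y + y ^ 2 = 3 * c :=
      mul_left_cancel₀ (sub_ne_zero.2 hxy) (by linear_combination hx - hy)
    have h₂ : x ^ 2 + x * z + z ^ 2 = 3 * c :=
      mul_left_cancel₀ (sub_ne_zero.2 hxz) (by linear_combination hx - hz)
    have h₃ : (y - z) * (x + (y + z)) = 0 := by linear_combination h₁ - h₂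
    exact hxyz (eq_neg_of_add_eq_zero_left ((mul_eq_zero.1 h₃).resolve_left (sub_ne_zero.2 hyz)))
  · push Not at h
    refine (card_le_one.2 fun y hy z hz ↦ h y z ?_ ?_).trans (by norm_num)
    · simpa using hy
    · simpa using hz

/-- Cardano's criterion, as an inequality: the number of roots of `y³ - 3cy + c` is bounded by a
sum of values of a cubic character over the roots of the resolvent quadratic. -/
lemma exists_card_cubic_roots_le {ω : MulChar F ℂ} (hω : ω ^ 3 = 1) {ζ : F}
    (hζ : ζ ^ 2 + ζ + 1 = 0) (h3 : (3 : F) ≠ 0) {c : F} (hc : c ≠ 0) :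
    ∃ n : ℕ, 1 + ∑ u with u * (1 - u) = c, ω u * ω⁻¹ (1 - u) = n ∧
      #{y : F | y ^ 3 = c * (3 * y - 1)} ≤ n := by
  by_cases hU : ∃ u, u * (1 - u) = c
  swap
  · refine ⟨1, ?_, card_le_one.2 fun y hy z hz ↦ ?_⟩
    · rw [filter_false_of_mem fun u _ hu ↦ hU ⟨u, hu⟩]
      simp
    · by_contra hyz
      exact hU (exists_mul_one_sub_eq hζ h3 hc (by simpa using hy) (by simpa using hz) hyz)
  obtain ⟨u, hu⟩ := hU
  have hu0 : u ≠ 0 := by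
    rintro rfl
    exact hc (by simpa using hu.symm)
  have hu1 : 1 - u ≠ 0 := fun h ↦ hc (by simpa [h] using hu.symm)
  have hωu : ω u ≠ 0 := (hu0.isUnit.map ω).ne_zero
  have hωu1 : ω (1 - u) ≠ 0 := (hu1.isUnit.map ω).ne_zero
  have hfib : ({v | v * (1 - v) = c} : Finset F) = {u, 1 - u} := by
    ext v
    simp only [mem_filter, mem_univ, true_and, mem_insert, mem_singleton]
    constructor
    · intro hv
      have : (v - u) * (v - (1 - u)) = 0 := by linear_combination hu - hv
      simpa [sub_eq_zero] using this
    · rintro (rfl | rfl)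
      · exact hu
      · linear_combination hu
  rw [hfib]
  by_cases hdouble : u = 1 - u
  · refine ⟨2, ?_, (card_le_card (t := {u, -2 * u}) fun y hy ↦ ?_).trans card_le_two⟩
    · rw [← hdouble, pair_eq_singleton, sum_singleton, ← hdouble, MulChar.inv_apply_eq_inv',
        mul_inv_cancel₀ hωu]
      norm_num
    · simp only [mem_filter, mem_univ, true_and, mem_insert, mem_singleton] at hy ⊢
      have : (y - u) ^ 2 * (y + 2 * u) = 0 := by grind
      rcases mul_eq_zero.1 this with h | h
      · exact .inl (sub_eq_zero.1 (pow_eq_zero_iff two_ne_zero |>.1 h))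
      · exact .inr (by linear_combination h)
  rw [sum_pair hdouble, sub_sub_cancel, MulChar.inv_apply_eq_inv', MulChar.inv_apply_eq_inv']
  by_cases hs : ω u = ω (1 - u)
  · refine ⟨3, ?_, card_cubic_roots_le_three c⟩
    rw [hs, mul_inv_cancel₀ hωu1]
    norm_num
  · refine ⟨0, ?_, ?_⟩
    · have cube (x : F) (hx : x ≠ 0) : ω x ^ 3 = 1 := by
        rw [← map_pow, MulChar.apply_pow_three_eq_one hω hx]
      have h₁ := cube u hu0
      have h₂ := cube (1 - u) hu1
      have h₃ : ω u ^ 2 + ω u * ω (1 - u) + ω (1 - u) ^ 2 = 0 :=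
        mul_left_cancel₀ (sub_ne_zero.2 hs) (by linear_combination h₁ - h₂)
      field_simp
      linear_combination h₃
    · rw [Nat.le_zero, card_eq_zero, filter_eq_empty_iff]
      intro y _ hy
      have := MulChar.apply_mul_inv_apply_one_sub_eq_one hω hc hy hu
      rw [MulChar.inv_apply_eq_inv', mul_inv_eq_one₀ hωu1] at this
      exact hs this

end CubicFiber

section JacobiSum

variable {F : Type*} [Field F] [Fintype F]

lemma sum_card_cubic_roots [DecidableEq F] (h3 : (3 : F) ≠ 0) (χ : MulChar F ℂ) :
    ∑ c, χ c * (#{y : F | y ^ 3 = c * (3 * y - 1)} : ℂ) =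
      χ⁻¹ 27 * jacobiSum (χ⁻¹ ^ 2) χ⁻¹ := by
  have hswap : ∑ c, χ c * (#{y : F | y ^ 3 = c * (3 * y - 1)} : ℂ) =
      ∑ y, χ y ^ 3 * χ⁻¹ (3 * y - 1) := by
    simp_rw [card_filter, Nat.cast_sum, mul_sum]
    rw [sum_comm]
    refine sum_congr rfl fun y _ ↦ ?_
    by_cases hy : 3 * y - 1 = 0
    · have hy0 : y ≠ 0 := by
        rintro rfl
        simp at hy
      simp [hy, hy0, MulChar.map_zero]
    · rw [sum_eq_single (y ^ 3 / (3 * y - 1))]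
      · rw [if_pos (div_mul_cancel₀ _ hy).symm, Nat.cast_one, mul_one, div_eq_mul_inv, map_mul,
          map_pow, MulChar.inv_apply']
      · intro c _ hc
        rw [if_neg fun h ↦ hc (by rw [h, mul_div_cancel_right₀ _ hy])]
        simp
      · simp
  rw [hswap, jacobiSum, mul_sum]
  let σ : F ≃ F := (Equiv.mulLeft₀ 3 h3).trans (Equiv.inv F)
  rw [← Equiv.sum_comp σ]
  refine sum_congr rfl fun v _ ↦ ?_
  change χ (3 * v)⁻¹ ^ 3 * χ⁻¹ (3 * (3 * v)⁻¹ - 1) = _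
  rcases eq_or_ne v 0 with rfl | hv
  · simp [MulChar.map_zero]
  have h₁ : 3 * (3 * v)⁻¹ - 1 = v⁻¹ * (1 - v) := by field_simp
  have h₂ : (27 : F) = 3 ^ 3 := by norm_num
  have hχv : χ v ≠ 0 := (hv.isUnit.map χ).ne_zero
  rw [h₁, h₂, map_mul, ← MulChar.inv_apply', MulChar.pow_apply' _ two_ne_zero, map_mul, map_pow,
    MulChar.inv_apply' χ v⁻¹, inv_inv, MulChar.inv_apply_eq_inv' χ v]
  field_simp

lemma sum_fiber_mul_one_sub [DecidableEq F] (χ ω : MulChar F ℂ) :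
    ∑ c, χ c * ∑ u with u * (1 - u) = c, ω u * ω⁻¹ (1 - u) = jacobiSum (χ * ω) (χ * ω⁻¹) := by
  simp_rw [sum_filter, mul_sum]
  rw [sum_comm, jacobiSum]
  refine sum_congr rfl fun u _ ↦ ?_
  rw [sum_eq_single (u * (1 - u))]
  · simp only [if_true, map_mul, MulChar.mul_apply]
    ring
  · intro c _ hc
    simp [hc.symm]
  · simp

/-- An evaluation of the Jacobi sum of two twists of `χ` by a cubic character. -/
theorem jacobiSum_mul_cubic {ω : MulChar F ℂ} (hω : ω ^ 3 = 1) (hω1 : ω ≠ 1) {ζ : F}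
    (hζ : ζ ^ 2 + ζ + 1 = 0) (h3 : (3 : F) ≠ 0) {χ : MulChar F ℂ} (hχ : χ ≠ 1) :
    jacobiSum (χ * ω) (χ * ω⁻¹) = χ⁻¹ 27 * jacobiSum (χ⁻¹ ^ 2) χ⁻¹ := by
  classical
  choose! n hn hle using fun c : F ↦ exists_card_cubic_roots_le (c := c) hω hζ h3
  have hsum (φ : MulChar F ℂ) :
      ∑ c, φ c * (n c : ℂ) = ∑ c, φ c + jacobiSum (φ * ω) (φ * ω⁻¹) := by
    rw [← sum_fiber_mul_one_sub, ← sum_add_distrib]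
    refine sum_congr rfl fun c _ ↦ ?_
    rcases eq_or_ne c 0 with rfl | hc
    · simp [MulChar.map_zero]
    · rw [← hn c hc]
      ring
  have hone (f : F → ℕ) :
      ∑ c, (1 : MulChar F ℂ) c * (f c : ℂ) = ((∑ c with c ≠ 0, f c : ℕ) : ℂ) := by
    rw [Nat.cast_sum, sum_filter]
    refine sum_congr rfl fun c _ ↦ ?_
    rcases eq_or_ne c 0 with rfl | hc
    · simp [MulChar.map_zero]
    · simp [MulChar.one_apply hc.isUnit, hc]
  have htotal : ∑ c with c ≠ 0, #{y : F | y ^ 3 = c * (3 * y - 1)} = ∑ c with c ≠ 0, n c := by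
    have h27 : (27 : F) ≠ 0 := by
      rw [show (27 : F) = 3 ^ 3 by norm_num]
      exact pow_ne_zero _ h3
    rw [← Nat.cast_inj (R := ℂ), ← hone, ← hone, sum_card_cubic_roots h3, hsum,
      MulChar.sum_one_eq_card_units, one_mul, one_mul, jacobiSum_nontrivial_inv hω1,
      MulChar.apply_neg_one_of_pow_three_eq_one hω, inv_one,
      one_pow, jacobiSum_one_one, MulChar.one_apply h27.isUnit,
      Fintype.card_eq_card_units_add_one (α := F)]
    push_cast
    ring
  have heq := (sum_eq_sum_iff_of_le fun c hc ↦ hle c (by simpa using hc)).1 htotal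
  have hJ := hsum χ
  rw [MulChar.sum_eq_zero_of_ne_one hχ, zero_add] at hJ
  rw [← hJ, ← sum_card_cubic_roots h3]
  refine sum_congr rfl fun c _ ↦ ?_
  rcases eq_or_ne c 0 with rfl | hc
  · simp [MulChar.map_zero]
  · rw [heq c (by simpa using hc)]

end JacobiSum

section GaussSum

variable {F : Type*} [Field F] [Fintype F]

lemma gaussSum_mul_gaussSum_inv {χ : MulChar F ℂ} (hχ : χ ≠ 1) {ψ : AddChar F ℂ}
    (hψ : ψ.IsPrimitive) :
    gaussSum χ ψ * gaussSum χ⁻¹ ψ = χ (-1) * Fintype.card F := by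
  rw [← mul_gaussSum_inv_eq_gaussSum χ⁻¹ ψ, mul_left_comm, gaussSum_mul_gaussSum_eq_card hχ hψ,
    MulChar.inv_apply', inv_neg_one]

/-- The Davenport–Hasse product relation for `m = 3`. -/
theorem gaussSum_mul_cubic_twists {ω : MulChar F ℂ} (hω : ω ^ 3 = 1) (hω1 : ω ≠ 1) {ζ : F}
    (hζ : ζ ^ 2 + ζ + 1 = 0) (h3 : (3 : F) ≠ 0) {χ : MulChar F ℂ} (hχ : χ ^ 3 ≠ 1)
    {ψ : AddChar F ℂ} (hψ : ψ.IsPrimitive) :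
    gaussSum χ ψ * gaussSum (χ * ω) ψ * gaussSum (χ * ω⁻¹) ψ =
      Fintype.card F * χ⁻¹ 27 * gaussSum (χ ^ 3) ψ := by
  have hχ1 : χ ≠ 1 := by
    rintro rfl
    simp at hχ
  have hJ := jacobiSum_mul_cubic hω hω1 hζ h3 hχ1
  have hprod : χ * ω * (χ * ω⁻¹) = χ ^ 2 := by
    rw [mul_mul_mul_comm, mul_inv_cancel, mul_one, sq]
  by_cases hχ2 : χ ^ 2 = 1
  · have hinv : χ * ω⁻¹ = (χ * ω)⁻¹ := eq_inv_of_mul_eq_one_right (hprod.trans hχ2)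
    have hχω : χ * ω ≠ 1 := fun h ↦ hχ <| by
      rw [eq_inv_of_mul_eq_one_left h, inv_pow, hω, inv_one]
    have hχinv : χ⁻¹ ≠ 1 := inv_ne_one.2 hχ1
    rw [hinv, jacobiSum_nontrivial_inv hχω, inv_pow, hχ2, inv_one,
      jacobiSum_one_nontrivial hχinv] at hJ
    rw [hinv, mul_assoc, gaussSum_mul_gaussSum_inv hχω hψ, pow_succ, hχ2, one_mul]
    linear_combination (-(Fintype.card F : ℂ) * gaussSum χ ψ) * hJ
  · have h₁ := jacobiSum_mul_nontrivial (hprod ▸ hχ2) ψ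
    have hpow : χ ^ 2 * χ ≠ 1 := by rwa [← pow_succ]
    have h₂ := jacobiSum_mul_nontrivial hpow ψ
    have hring : ringChar ℂ ≠ ringChar F := by
      rw [ringChar.eq_zero]
      exact (CharP.ringChar_ne_zero_of_finite F).symm
    have h₃ := jacobiSum_mul_jacobiSum_inv hring hχ2 hχ1 hpow
    rw [← inv_pow] at h₃
    rw [hprod, hJ] at h₁
    rw [← pow_succ] at h₂
    linear_combination (-gaussSum χ ψ) * h₁ - χ⁻¹ 27 * jacobiSum (χ⁻¹ ^ 2) χ⁻¹ * h₂ +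
      χ⁻¹ 27 * gaussSum (χ ^ 3) ψ * h₃

/-- The product relation in the degenerate case where `χ` is a power of the cubic character. -/
lemma gaussSum_mul_cubic_twists_of_mem {ω : MulChar F ℂ} (hω : ω ^ 3 = 1) (hω1 : ω ≠ 1)
    (h3 : (3 : F) ≠ 0) {χ : MulChar F ℂ} (hχ : χ = 1 ∨ χ = ω ∨ χ = ω⁻¹)
    {ψ : AddChar F ℂ} (hψ : ψ.IsPrimitive) (hψ1 : ψ ≠ 1) :
    gaussSum χ ψ * gaussSum (χ * ω) ψ * gaussSum (χ * ω⁻¹) ψ =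
      Fintype.card F * χ⁻¹ 27 * gaussSum (χ ^ 3) ψ := by
  have hχ3 : χ ^ 3 = 1 := by
    rcases hχ with rfl | rfl | rfl
    · exact one_pow 3
    · exact hω
    · rw [inv_pow, hω, inv_one]
  have h27 : χ⁻¹ 27 = 1 := by
    rw [show (27 : F) = 3 ^ 3 by norm_num]
    exact MulChar.apply_pow_three_eq_one (by rw [inv_pow, hχ3, inv_one]) h3
  have hprod : gaussSum ω ψ * gaussSum ω⁻¹ ψ = Fintype.card F := by
    rw [gaussSum_mul_gaussSum_inv hω1 hψ, MulChar.apply_neg_one_of_pow_three_eq_one hω, one_mul]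
  have hone := gaussSum_one_left hψ1
  have hsq : ω * ω = ω⁻¹ := eq_inv_of_mul_eq_one_left (by rw [← pow_three', hω])
  rw [hχ3, h27, hone]
  rcases hχ with rfl | rfl | rfl
  · rw [one_mul, one_mul, hone]
    linear_combination -hprod
  · rw [mul_inv_cancel, hsq, hone]
    linear_combination -hprod
  · rw [inv_mul_cancel, ← mul_inv, hsq, inv_inv, hone]
    linear_combination -hprod

end GaussSum

section Generator

variable {F : Type*} [Field F] [Fintype F]

lemma MulChar.orderOf_eq_card_sub_one_of_generator {T : MulChar F ℂ}
    (hT : ∀ χ : MulChar F ℂ, ∃ n : ℕ, χ = T ^ n) : orderOf T = Fintype.card F - 1 := by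
  classical
  rw [orderOf_eq_card_of_forall_mem_zpowers fun χ ↦ ?_,
    MulChar.card_eq_card_units_of_hasEnoughRootsOfUnity, Nat.card_eq_fintype_card,
    Fintype.card_units]
  obtain ⟨n, rfl⟩ := hT χ
  exact Subgroup.npow_mem_zpowers T n

lemma FiniteField.three_ne_zero_of_card_mod_three (h : Fintype.card F % 3 = 1) :
    (3 : F) ≠ 0 := by
  intro h3
  have hcard := FiniteField.cast_card_eq_zero F
  rw [← Nat.div_add_mod (Fintype.card F) 3, h] at hcard
  push_cast at hcard
  simp [h3] at hcard

lemma FiniteField.exists_primitive_cube_root (h : Fintype.card F % 3 = 1) :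
    ∃ ζ : F, ζ ^ 2 + ζ + 1 = 0 := by
  classical
  have hdvd : 3 ∣ Fintype.card Fˣ := by
    rw [Fintype.card_units]
    lia
  have : Fact (Nat.Prime 3) := ⟨Nat.prime_three⟩
  obtain ⟨ζ, hζ⟩ := exists_prime_orderOf_dvd_card 3 hdvd
  have hζ3 : (ζ : F) ^ 3 = 1 := by
    rw [← Units.val_pow_eq_pow_val, ← hζ, pow_orderOf_eq_one, Units.val_one]
  have hζ1 : (ζ : F) ≠ 1 := fun h1 ↦ by
    rw [Units.val_eq_one.1 h1, orderOf_one] at hζ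
    norm_num at hζ
  exact ⟨ζ, mul_left_cancel₀ (sub_ne_zero.2 hζ1) (by linear_combination hζ3)⟩

end Generator

section Theta

variable (p : ℕ) [Fact p.Prime] (F : Type) [Field F] [Fintype F] [Algebra (ZMod p) F]

/-- `theta` as an additive character. -/
noncomputable def thetaChar : AddChar F ℂ :=
  (ZMod.stdAddChar (N := p)).compAddMonoidHom (Algebra.trace (ZMod p) F).toAddMonoidHom

lemma thetaChar_apply (x : F) : thetaChar p F x = theta p F x :=
  ZMod.toCircle_apply _

lemma thetaChar_ne_one : thetaChar p F ≠ 1 := by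
  intro h
  obtain ⟨x, hx⟩ := Algebra.trace_surjective (ZMod p) F 1
  have hx1 : ZMod.stdAddChar (Algebra.trace (ZMod p) F x) = 1 := DFunLike.congr_fun h x
  rw [hx, ← AddChar.map_zero_eq_one (ZMod.stdAddChar (N := p))] at hx1
  exact one_ne_zero (ZMod.injective_stdAddChar hx1)

lemma gaussT_eq_gaussSum (T : MulChar F ℂ) (m : ℤ) :
    gaussT p F T m = gaussSum (T ^ m) (thetaChar p F) := by
  simp only [gaussT, gaussSum, thetaChar_apply]

end Theta

theorem stmt_2 (p e : ℕ) [Fact p.Prime] (he : 0 < e)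
    (F : Type) [Field F] [Fintype F] [Algebra (ZMod p) F]
    (hq : Fintype.card F = p ^ e) (h3 : Fintype.card F % 3 = 1)
    (T : MulChar F ℂ) (hT : ∀ χ : MulChar F ℂ, ∃ n : ℕ, χ = T ^ n)
    (k : ℤ) :
    gaussT p F T k * gaussT p F T (k + (((Fintype.card F - 1) / 3 : ℕ) : ℤ)) *
        gaussT p F T (k + 2 * (((Fintype.card F - 1) / 3 : ℕ) : ℤ)) =
      (Fintype.card F : ℂ) * (T ^ (-k)) (27 : F) * gaussT p F T (3 * k) := by
  set N := (Fintype.card F - 1) / 3 with hN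
  have hord : orderOf T = 3 * N := by
    rw [MulChar.orderOf_eq_card_sub_one_of_generator hT]
    lia
  have hN0 : N ≠ 0 := by
    have := Fintype.one_lt_card (α := F)
    lia
  have hω : (T ^ N) ^ 3 = 1 := by rw [← pow_mul, mul_comm, ← hord, pow_orderOf_eq_one]
  have hω1 : T ^ N ≠ 1 := fun h ↦ by
    have := Nat.le_of_dvd (Nat.pos_of_ne_zero hN0) (orderOf_dvd_of_pow_eq_one h)
    lia
  have h3F := FiniteField.three_ne_zero_of_card_mod_three h3
  obtain ⟨ζ, hζ⟩ := FiniteField.exists_primitive_cube_root h3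
  have hψ1 := thetaChar_ne_one p F
  have hψ := AddChar.IsPrimitive.of_ne_one hψ1
  have hinv : T ^ (2 * (N : ℤ)) = (T ^ N)⁻¹ := by
    refine eq_inv_of_mul_eq_one_left ?_
    rw [mul_comm 2, zpow_mul, zpow_natCast, zpow_ofNat, ← pow_succ, hω]
  simp only [gaussT_eq_gaussSum]
  rw [zpow_add, zpow_add, zpow_natCast, hinv, zpow_neg, mul_comm 3 k, zpow_mul, zpow_ofNat]
  by_cases hk : (T ^ k) ^ 3 = 1
  · refine gaussSum_mul_cubic_twists_of_mem hω hω1 h3F ?_ hψ hψ1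
    have hdvd : (N : ℤ) ∣ k := by
      rw [← zpow_ofNat, ← zpow_mul, ← orderOf_dvd_iff_zpow_eq_one, hord] at hk
      push_cast at hk
      rw [mul_comm k] at hk
      exact Int.dvd_of_mul_dvd_mul_left (by norm_num) hk
    obtain ⟨j, rfl⟩ := hdvd
    rw [zpow_mul, zpow_natCast, ← Int.mul_ediv_add_emod j 3, zpow_add, zpow_mul, zpow_ofNat, hω,
      one_zpow, one_mul]
    have h0 := Int.emod_nonneg j (by norm_num : (3 : ℤ) ≠ 0)
    have h1 := Int.emod_lt_of_pos j (by norm_num : (0 : ℤ) < 3)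
    interval_cases h : j % 3
    · exact .inl (zpow_zero _)
    · exact .inr (.inl (zpow_one _))
    · refine .inr (.inr ?_)
      rw [← hinv, mul_comm 2, zpow_mul, zpow_natCast]
  · exact gaussSum_mul_cubic_twists hω hω1 hζ h3F hk hψ
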